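/- arXiv:1409.3494 — 5 statements merged into one kernel-verified Lean document; each statement's English description precedes it below -/
import Mathlib

section
/- Let K, N be positive naturals and G = [g_{ij}] a real K×N matrix. For register labels k, k' : Fin K → {0,1} define E_{kn} = (1/2)·∑_{i=1}^{K} (-1)^{k_i} · ∑_{j=1}^{N} (-1)^{n_j} g_{ij}. Then the following are equivalent: (a) for every strictly positive probability vector p on environment labels n : Fin N → {0,1} and every t ∈ ℝ, the decoherence rate r_{kk'}(t) = ∑_n p_n · exp(-i·(E_{kn} - E_{k'n})·t) equals 1; (b) for every environment label n : Fin N → {0,1}, ∑_{i=1}^{K} [(-1)^{k_i} - (-1)^{k'_i}] · ∑_{j=1}^{N} g_{ij}·(-1)^{n_j} = 0. -/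
/-- A real frequency whose cosine stays at `1` for all times vanishes. -/
theorem Real.eq_zero_of_forall_cos_mul_eq_one {x : ℝ} (h : ∀ t : ℝ, Real.cos (x * t) = 1) :
    x = 0 := by
  by_contra hx
  have h1 := h (Real.pi / x)
  rw [mul_div_cancel₀ _ hx, Real.cos_pi] at h1
  norm_num at h1

/-- If a convex combination with positive weights of the phases `exp (-i d t)` equals `1`, then
every phase has cosine `1`. -/
theorem cos_eq_one_of_sum_mul_exp_eq_one {ι : Type*} [Fintype ι] {p d : ι → ℝ} {t : ℝ}
    (hp : ∀ i, 0 < p i) (hsum : ∑ i, p i = 1)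
    (h : ∑ i, (p i : ℂ) * Complex.exp (-Complex.I * (d i : ℂ) * t) = 1) (i : ι) :
    Real.cos (d i * t) = 1 := by
  have hre : ∑ i, p i * Real.cos (d i * t) = 1 := by
    have h1 := congrArg Complex.re h
    rw [Complex.re_sum, Complex.one_re] at h1
    rw [← h1]
    refine Finset.sum_congr rfl fun j _ => ?_
    have h2 : -Complex.I * (d j : ℂ) * t = ((-(d j * t) : ℝ) : ℂ) * Complex.I := by
      push_cast
      ring
    rw [h2, Complex.re_ofReal_mul, Complex.exp_ofReal_mul_I_re, Real.cos_neg]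
  have hle : ∀ j ∈ Finset.univ, p j * Real.cos (d j * t) ≤ p j := fun j _ =>
    mul_le_of_le_one_right (hp j).le (Real.cos_le_one _)
  have heq := (Finset.sum_eq_sum_iff_of_le hle).1 (hre.trans hsum.symm) i (Finset.mem_univ i)
  exact (mul_eq_left₀ (hp i).ne').1 heq

/-- **No-decoherence condition.** The decoherence rate
`r_{kk'}(t) = ∑ n p n * exp(-i (E_{kn} - E_{k'n}) t)` equals `1` for every
strictly positive probability vector `p` and every time `t` if and only if
`∑ i ((-1)^(k i) - (-1)^(k' i)) * ∑ j g i j * (-1)^(n j) = 0` for all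
environment labels `n`. -/
theorem stmt_3 (K N : ℕ) (hK : 0 < K) (hN : 0 < N)
    (G : Fin K → Fin N → ℝ)
    (E : (Fin K → Fin 2) → (Fin N → Fin 2) → ℝ)
    (hE : ∀ (k : Fin K → Fin 2) (n : Fin N → Fin 2),
      E k n = (1 / 2) * ∑ i, (-1 : ℝ) ^ (k i : ℕ) *
        ∑ j, (-1 : ℝ) ^ (n j : ℕ) * G i j)
    (k k' : Fin K → Fin 2) :
    (∀ p : (Fin N → Fin 2) → ℝ, (∀ n, 0 < p n) → (∑ n, p n = 1) →
      ∀ t : ℝ, ∑ n : Fin N → Fin 2,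
        (p n : ℂ) * Complex.exp (-Complex.I * ((E k n : ℝ) - E k' n) * t) = 1)
    ↔ (∀ n : Fin N → Fin 2,
        ∑ i, ((-1 : ℝ) ^ (k i : ℕ) - (-1 : ℝ) ^ (k' i : ℕ)) *
          ∑ j, G i j * (-1 : ℝ) ^ (n j : ℕ) = 0) := by
  have hdiff : ∀ n, ∑ i, ((-1 : ℝ) ^ (k i : ℕ) - (-1 : ℝ) ^ (k' i : ℕ)) *
      ∑ j, G i j * (-1 : ℝ) ^ (n j : ℕ) = 2 * (E k n - E k' n) := by
    intro n
    simp only [hE, sub_mul, Finset.sum_sub_distrib, mul_comm (G _ _)]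
    ring
  simp only [hdiff]
  constructor
  · intro h n
    have hcard : (0 : ℝ) < Fintype.card (Fin N → Fin 2) := by
      exact_mod_cast Fintype.card_pos
    have hpos : ∀ _ : Fin N → Fin 2, 0 < (Fintype.card (Fin N → Fin 2) : ℝ)⁻¹ := fun _ =>
      inv_pos.2 hcard
    have hsum : ∑ _ : Fin N → Fin 2, (Fintype.card (Fin N → Fin 2) : ℝ)⁻¹ = 1 := by
      rw [Finset.sum_const, Finset.card_univ, nsmul_eq_mul, mul_inv_cancel₀ hcard.ne']
    rw [Real.eq_zero_of_forall_cos_mul_eq_one fun t =>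
      cos_eq_one_of_sum_mul_exp_eq_one (d := fun n => E k n - E k' n) hpos hsum
        (by simpa only [Complex.ofReal_sub] using h _ hpos hsum t) n, mul_zero]
  · intro h p _ hsum t
    have hE' : ∀ n, E k n = E k' n := fun n => by linarith [h n]
    simp only [hE', sub_self, mul_zero, zero_mul, Complex.exp_zero, mul_one]
    exact_mod_cast hsum
end

section
/- Let K, N be positive naturals and suppose the interaction matrix has identical rows, g_{ij} = g_j for a vector g : Fin N → ℝ that is not identically zero (collective decoherence). Then for register labels k, k' : Fin K → {0,1}, the no-decoherence condition — for every n : Fin N → {0,1}, ∑_{i=1}^{K} [(-1)^{k_i} - (-1)^{k'_i}] · ∑_{j=1}^{N} g_j·(-1)^{n_j} = 0 — holds if and only if ∑_{i=1}^{K} (-1)^{k_i} = ∑_{i=1}^{K} (-1)^{k'_i}, equivalently if and only if the binary strings k and k' contain the same number of zeros. -/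
/-- A sum of spins is determined by the number of zero labels. -/
theorem sum_neg_one_pow_eq_card_filter_zero {ι : Type*} [Fintype ι] (k : ι → Fin 2) :
    ∑ i, (-1 : ℝ) ^ (k i : ℕ)
      = 2 * ((Finset.univ.filter fun i => k i = 0).card : ℝ) - Fintype.card ι := by
  have h : ∀ i, (-1 : ℝ) ^ (k i : ℕ) = 2 * (if k i = 0 then 1 else 0) - 1 := by
    intro i
    generalize k i = a
    fin_cases a <;> norm_num
  simp only [h, Finset.sum_sub_distrib, ← Finset.mul_sum, Finset.sum_boole]
  simp

/-- A nonzero coupling vector has a sign pattern with nonzero signed sum. -/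
theorem exists_sum_mul_neg_one_pow_ne_zero {ι : Type*} [Fintype ι] {g : ι → ℝ} (hg : g ≠ 0) :
    ∃ n : ι → Fin 2, ∑ j, g j * (-1 : ℝ) ^ (n j : ℕ) ≠ 0 := by
  refine ⟨fun j => if 0 ≤ g j then 0 else 1, ?_⟩
  have h : ∀ j, g j * (-1 : ℝ) ^ ((if 0 ≤ g j then 0 else 1 : Fin 2) : ℕ) = |g j| := by
    intro j
    split_ifs with hj
    · simp [abs_of_nonneg hj]
    · simp [abs_of_neg (not_le.mp hj)]
  obtain ⟨j, hj⟩ := Function.ne_iff.mp hg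
  simp only [h]
  exact (Finset.sum_pos' (fun i _ => abs_nonneg (g i))
    ⟨j, Finset.mem_univ j, abs_pos.mpr hj⟩).ne'

/-- **Collective decoherence.** If all register spins couple identically to
the environment, `g i j = g j` with `g ≠ 0`, then the no-decoherence
condition between register labels `k, k'` holds if and only if
`∑ i (-1)^(k i) = ∑ i (-1)^(k' i)`, equivalently iff `k` and `k'` have the
same number of zeros. -/
theorem stmt_4 (K N : ℕ) (hK : 0 < K) (hN : 0 < N)
    (g : Fin N → ℝ) (hg : g ≠ 0)
    (k k' : Fin K → Fin 2) :
    ((∀ n : Fin N → Fin 2,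
        ∑ i, ((-1 : ℝ) ^ (k i : ℕ) - (-1 : ℝ) ^ (k' i : ℕ)) *
          ∑ j, g j * (-1 : ℝ) ^ (n j : ℕ) = 0)
      ↔ ∑ i, (-1 : ℝ) ^ (k i : ℕ) = ∑ i, (-1 : ℝ) ^ (k' i : ℕ))
    ∧
    ((∀ n : Fin N → Fin 2,
        ∑ i, ((-1 : ℝ) ^ (k i : ℕ) - (-1 : ℝ) ^ (k' i : ℕ)) *
          ∑ j, g j * (-1 : ℝ) ^ (n j : ℕ) = 0)
      ↔ (Finset.univ.filter fun i => k i = 0).card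
          = (Finset.univ.filter fun i => k' i = 0).card) := by
  have h_sum : (∀ n : Fin N → Fin 2,
        ∑ i, ((-1 : ℝ) ^ (k i : ℕ) - (-1 : ℝ) ^ (k' i : ℕ)) *
          ∑ j, g j * (-1 : ℝ) ^ (n j : ℕ) = 0)
      ↔ ∑ i, (-1 : ℝ) ^ (k i : ℕ) = ∑ i, (-1 : ℝ) ^ (k' i : ℕ) := by
    simp only [← Finset.sum_mul, Finset.sum_sub_distrib]
    constructor
    · intro h
      obtain ⟨n, hn⟩ := exists_sum_mul_neg_one_pow_ne_zero hg
      exact sub_eq_zero.mp ((mul_eq_zero.mp (h n)).resolve_right hn)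
    · intro h n
      rw [h, sub_self, zero_mul]
  refine ⟨h_sum, h_sum.trans ?_⟩
  rw [sum_neg_one_pow_eq_card_filter_zero, sum_neg_one_pow_eq_card_filter_zero, sub_left_inj,
    mul_right_inj' two_ne_zero, Nat.cast_inj]
end

section
/- Let K, N be positive naturals, G = [g_{ij}] a real K×N matrix, and k, k' : Fin K → {0,1} register labels that differ exactly at two indices l₁ ≠ l₂ and satisfy k_{l₁} = k_{l₂} (hence k'_{l₁} = k'_{l₂} ≠ k_{l₁}). Then the no-decoherence condition — for every n : Fin N → {0,1}, ∑_{i=1}^{K} [(-1)^{k_i} - (-1)^{k'_i}] · ∑_{j=1}^{N} g_{ij}·(-1)^{n_j} = 0 — holds if and only if g_{l₁ j} = -g_{l₂ j} for every j ∈ Fin N, i.e. row l₂ of G equals row l₁ multiplied by -1. -/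
/-- A real linear form vanishes on all sign vectors iff all its coefficients vanish. -/
theorem forall_sum_mul_neg_one_pow_eq_zero_iff {ι : Type*} [Fintype ι] (c : ι → ℝ) :
    (∀ n : ι → Fin 2, ∑ j, c j * (-1 : ℝ) ^ (n j : ℕ) = 0) ↔ ∀ j, c j = 0 := by
  classical
  refine ⟨fun h j => ?_, fun h n => by simp [h]⟩
  have h₀ := h 0
  have h₁ := h (Pi.single j 1)
  rw [← Finset.add_sum_erase _ _ (Finset.mem_univ j)] at h₀ h₁
  have hrest : ∑ x ∈ Finset.univ.erase j, c x * (-1 : ℝ) ^ ((Pi.single j 1 : ι → Fin 2) x : ℕ) =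
      ∑ x ∈ Finset.univ.erase j, c x * (-1 : ℝ) ^ ((0 : ι → Fin 2) x : ℕ) :=
    Finset.sum_congr rfl fun x hx => by
      rw [Pi.single_eq_of_ne (Finset.ne_of_mem_erase hx), Pi.zero_apply]
  rw [hrest] at h₁
  simp only [Pi.single_eq_same, Pi.zero_apply, Fin.val_zero, Fin.val_one, pow_zero, pow_one]
    at h₀ h₁
  linarith

/-- Distinct bits have distinct signs. -/
theorem neg_one_pow_sub_neg_one_pow_ne_zero {a b : Fin 2} (h : a ≠ b) :
    (-1 : ℝ) ^ (a : ℕ) - (-1 : ℝ) ^ (b : ℕ) ≠ 0 := by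
  fin_cases a <;> fin_cases b <;> first | exact absurd rfl h | norm_num

/-- **Case 1.** If `k, k'` differ exactly at two indices `l₁ ≠ l₂` and
`k l₁ = k l₂` (so the pair has the form `|…1…1…⟩, |…0…0…⟩`), then the
no-decoherence condition holds iff row `l₂` of `G` is `-1` times row `l₁`. -/
theorem stmt_5 (K N : ℕ) (hK : 0 < K) (hN : 0 < N)
    (G : Fin K → Fin N → ℝ)
    (k k' : Fin K → Fin 2) (l₁ l₂ : Fin K) (hl : l₁ ≠ l₂)
    (hdiff₁ : k l₁ ≠ k' l₁) (hdiff₂ : k l₂ ≠ k' l₂)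
    (hsame : ∀ i, i ≠ l₁ → i ≠ l₂ → k i = k' i)
    (heq : k l₁ = k l₂) :
    (∀ n : Fin N → Fin 2,
        ∑ i, ((-1 : ℝ) ^ (k i : ℕ) - (-1 : ℝ) ^ (k' i : ℕ)) *
          ∑ j, G i j * (-1 : ℝ) ^ (n j : ℕ) = 0)
      ↔ ∀ j : Fin N, G l₁ j = -G l₂ j := by
  have heq' : k' l₁ = k' l₂ := by omega
  have hsum (n : Fin N → Fin 2) :
      ∑ i, ((-1 : ℝ) ^ (k i : ℕ) - (-1 : ℝ) ^ (k' i : ℕ)) *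
          ∑ j, G i j * (-1 : ℝ) ^ (n j : ℕ) =
        ((-1 : ℝ) ^ (k l₁ : ℕ) - (-1 : ℝ) ^ (k' l₁ : ℕ)) *
          ∑ j, (G l₁ j + G l₂ j) * (-1 : ℝ) ^ (n j : ℕ) := by
    rw [Fintype.sum_eq_add l₁ l₂ hl fun i hi => by simp [hsame i hi.1 hi.2], ← heq, ← heq',
      ← mul_add, ← Finset.sum_add_distrib]
    simp only [add_mul]
  simp only [hsum, mul_eq_zero, neg_one_pow_sub_neg_one_pow_ne_zero hdiff₁, false_or,
    forall_sum_mul_neg_one_pow_eq_zero_iff, eq_neg_iff_add_eq_zero]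
end

section
/- Let K, N be positive naturals, G = [g_{ij}] a real K×N matrix, and k, k' : Fin K → {0,1} register labels that differ exactly at two indices l₁ ≠ l₂ and satisfy k_{l₁} ≠ k_{l₂} (hence k_{l₁} = k'_{l₂} and k_{l₂} = k'_{l₁}). Then the no-decoherence condition — for every n : Fin N → {0,1}, ∑_{i=1}^{K} [(-1)^{k_i} - (-1)^{k'_i}] · ∑_{j=1}^{N} g_{ij}·(-1)^{n_j} = 0 — holds if and only if g_{l₁ j} = g_{l₂ j} for every j ∈ Fin N, i.e. rows l₁ and l₂ of G coincide. -/
/-- A real linear form vanishing at every vector of signs is zero. -/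
theorem forall_sum_mul_sign_eq_zero_iff {ι : Type*} [Fintype ι] (d : ι → ℝ) :
    (∀ n : ι → Fin 2, ∑ j, d j * (-1 : ℝ) ^ (n j : ℕ) = 0) ↔ ∀ j, d j = 0 := by
  classical
  refine ⟨fun h j => ?_, fun h n => by simp [h]⟩
  have h₀ := h 0
  have h₁ := h (Pi.single j 1)
  rw [← Finset.add_sum_erase _ _ (Finset.mem_univ j)] at h₀ h₁
  have hrest : ∑ i ∈ Finset.univ.erase j,
        d i * (-1 : ℝ) ^ ((Pi.single j 1 : ι → Fin 2) i : ℕ) =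
      ∑ i ∈ Finset.univ.erase j, d i * (-1 : ℝ) ^ ((0 : ι → Fin 2) i : ℕ) :=
    Finset.sum_congr rfl fun i hi => by
      simp [Pi.single_eq_of_ne (Finset.ne_of_mem_erase hi)]
  rw [hrest] at h₁
  simp only [Pi.single_eq_same, Pi.zero_apply, Fin.val_zero, Fin.val_one, pow_zero,
    pow_one] at h₀ h₁
  linarith

/-- Two sign differences coming from a transposed pair of distinct bits are
opposite and nonzero. -/
theorem sign_sub_sign_of_ne {a a' b b' : Fin 2} (ha : a ≠ a') (hb : b ≠ b') (hab : a ≠ b) :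
    (-1 : ℝ) ^ (b : ℕ) - (-1 : ℝ) ^ (b' : ℕ) = -((-1 : ℝ) ^ (a : ℕ) - (-1 : ℝ) ^ (a' : ℕ)) ∧
      (-1 : ℝ) ^ (a : ℕ) - (-1 : ℝ) ^ (a' : ℕ) ≠ 0 := by
  fin_cases a <;> fin_cases a' <;> fin_cases b <;> fin_cases b' <;> norm_num at *


/-- **Case 2.** If `k, k'` differ exactly at two indices `l₁ ≠ l₂` and
`k l₁ ≠ k l₂` (so the pair has the form `|…0…1…⟩, |…1…0…⟩`), then the
no-decoherence condition holds iff rows `l₁` and `l₂` of `G` coincide. -/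
theorem stmt_6 (K N : ℕ) (hK : 0 < K) (hN : 0 < N)
    (G : Fin K → Fin N → ℝ)
    (k k' : Fin K → Fin 2) (l₁ l₂ : Fin K) (hl : l₁ ≠ l₂)
    (hdiff₁ : k l₁ ≠ k' l₁) (hdiff₂ : k l₂ ≠ k' l₂)
    (hsame : ∀ i, i ≠ l₁ → i ≠ l₂ → k i = k' i)
    (hne : k l₁ ≠ k l₂) :
    (∀ n : Fin N → Fin 2,
        ∑ i, ((-1 : ℝ) ^ (k i : ℕ) - (-1 : ℝ) ^ (k' i : ℕ)) *
          ∑ j, G i j * (-1 : ℝ) ^ (n j : ℕ) = 0)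
      ↔ ∀ j : Fin N, G l₁ j = G l₂ j := by
  obtain ⟨hopp, hc⟩ := sign_sub_sign_of_ne hdiff₁ hdiff₂ hne
  have key (n : Fin N → Fin 2) :
      ∑ i, ((-1 : ℝ) ^ (k i : ℕ) - (-1 : ℝ) ^ (k' i : ℕ)) *
          ∑ j, G i j * (-1 : ℝ) ^ (n j : ℕ) =
        ((-1 : ℝ) ^ (k l₁ : ℕ) - (-1 : ℝ) ^ (k' l₁ : ℕ)) *
          ∑ j, (G l₁ j - G l₂ j) * (-1 : ℝ) ^ (n j : ℕ) := by
    rw [Fintype.sum_eq_add l₁ l₂ hl fun i hi => by simp [hsame i hi.1 hi.2], hopp]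
    simp only [sub_mul, Finset.sum_sub_distrib]
    ring
  simp only [key, mul_eq_zero, hc, false_or]
  simpa only [sub_eq_zero] using forall_sum_mul_sign_eq_zero_iff fun j => G l₁ j - G l₂ j
end

section
/- Let K, N be positive naturals, G = [g_{ij}] a real K×N matrix, and define S_{kn} = ∑_{i=1}^{K} (-1)^{k_i} · ∑_{j=1}^{N} (-1)^{n_j} g_{ij} for k : Fin K → {0,1}, n : Fin N → {0,1}. Let Δ be a set of register labels such that for all k, k' ∈ Δ and all n, S_{kn} = S_{k'n} (so the span of {|k⟩ : k ∈ Δ} is a decoherence-free subspace). Then the set Δ' = {k̄ : k ∈ Δ} of bitwise complements also satisfies: for all k, k' ∈ Δ' and all n, S_{kn} = S_{k'n}. In other words, every decoherence-free subspace has a conjugate decoherence-free subspace of the same dimension. -/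
/-- Complementing a bit flips the sign it encodes. -/
theorem neg_one_pow_one_sub_bit (a : Fin 2) :
    (-1 : ℝ) ^ ((1 - a : Fin 2) : ℕ) = -(-1 : ℝ) ^ (a : ℕ) := by
  fin_cases a <;> simp

/-- **Conjugate DFS.** If a set `Δ` of register labels spans a
decoherence-free subspace (i.e. `S k n = S k' n` for all `k, k' ∈ Δ` and all
`n`), then the set `Δ'` of bitwise complements of elements of `Δ` also spans
a decoherence-free subspace, and it has the same dimension
(`Δ'.ncard = Δ.ncard`). -/
theorem stmt_9 (K N : ℕ) (hK : 0 < K) (hN : 0 < N)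
    (G : Fin K → Fin N → ℝ)
    (S : (Fin K → Fin 2) → (Fin N → Fin 2) → ℝ)
    (hS : ∀ (k : Fin K → Fin 2) (n : Fin N → Fin 2),
      S k n = ∑ i, (-1 : ℝ) ^ (k i : ℕ) * ∑ j, (-1 : ℝ) ^ (n j : ℕ) * G i j)
    (Δ : Set (Fin K → Fin 2))
    (hΔ : ∀ k ∈ Δ, ∀ k' ∈ Δ, ∀ n : Fin N → Fin 2, S k n = S k' n)
    (Δ' : Set (Fin K → Fin 2))
    (hΔ' : Δ' = (fun (k : Fin K → Fin 2) => fun i => 1 - k i) '' Δ) :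
    (∀ k ∈ Δ', ∀ k' ∈ Δ', ∀ n : Fin N → Fin 2, S k n = S k' n)
      ∧ Δ'.ncard = Δ.ncard := by
  have S_compl (k : Fin K → Fin 2) (n : Fin N → Fin 2) :
      S (fun i => 1 - k i) n = -S k n := by
    simp only [hS, neg_one_pow_one_sub_bit, neg_mul, Finset.sum_neg_distrib]
  subst hΔ'
  constructor
  · rintro _ ⟨k, hk, rfl⟩ _ ⟨k', hk', rfl⟩ n
    simp only [S_compl, hΔ k hk k' hk' n]
  · refine Set.ncard_image_of_injective Δ fun k k' h => funext fun i => ?_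
    exact sub_right_injective (congrFun h i)
end
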